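/- Let λ > 0, and for each t > 0 let X_t and Y_t be independent Poisson-distributed random variables, both with mean λ·t. Then Var[min(X_t, Y_t)] / t converges to λ·(1 − 1/π) as t → ∞, where π is the circle constant. -/

import Mathlib

open MeasureTheory ProbabilityTheory Filter

/-- The Fourier kernel `v ↦ (1 - cos v) / v ^ 2`, whose dilates integrate to multiples of `|x|`. -/
noncomputable def absKernel (v : ℝ) : ℝ := (1 - Real.cos v) / v ^ 2

lemma absKernel_nonneg (v : ℝ) : 0 ≤ absKernel v :=
  div_nonneg (sub_nonneg.2 (Real.cos_le_one v)) (sq_nonneg v)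

lemma measurable_absKernel : Measurable absKernel := by
  unfold absKernel
  fun_prop

lemma integrable_absKernel : Integrable absKernel := by
  refine (integrable_inv_one_add_sq.const_mul 3).mono' measurable_absKernel.aestronglyMeasurable
    (ae_of_all _ fun v => ?_)
  rw [Real.norm_of_nonneg (absKernel_nonneg v), absKernel, ← div_eq_mul_inv]
  rcases eq_or_ne v 0 with rfl | hv
  · simp
  · rw [div_le_div_iff₀ (by positivity) (by positivity)]
    have h1 := Real.one_sub_sq_div_two_le_cos (x := v)
    have h2 := Real.neg_one_le_cos v
    nlinarith [sq_nonneg v, mul_nonneg (sq_nonneg v) (by linarith : 0 ≤ Real.cos v + 1)]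

lemma integral_absKernel_pos : 0 < ∫ v, absKernel v := by
  rw [integral_pos_iff_support_of_nonneg absKernel_nonneg integrable_absKernel]
  have hsub : Set.Ioo (0 : ℝ) 1 ⊆ Function.support absKernel := by
    intro v hv
    have hne : Real.cos v ≠ 1 := by
      rw [Ne, Real.cos_eq_one_iff_of_lt_of_lt] <;> linarith [hv.1, hv.2, Real.pi_gt_three]
    exact div_ne_zero (sub_ne_zero.2 hne.symm) (pow_ne_zero _ hv.1.ne')
  exact lt_of_lt_of_le (by simp) (measure_mono hsub)

lemma one_sub_cos_mul_div_sq (x u : ℝ) :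
    (1 - Real.cos (u * x)) / u ^ 2 = x ^ 2 * absKernel (u * x) := by
  unfold absKernel
  rcases eq_or_ne x 0 with rfl | hx
  · simp
  · rcases eq_or_ne u 0 with rfl | hu
    · simp
    · field_simp

lemma integrable_one_sub_cos_mul_div_sq (x : ℝ) :
    Integrable fun u : ℝ => (1 - Real.cos (u * x)) / u ^ 2 := by
  simp_rw [one_sub_cos_mul_div_sq]
  rcases eq_or_ne x 0 with rfl | hx
  · simp
  · exact (integrable_absKernel.comp_mul_right' hx).const_mul _

lemma integral_one_sub_cos_mul_div_sq (x : ℝ) :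
    ∫ u : ℝ, (1 - Real.cos (u * x)) / u ^ 2 = |x| * ∫ v, absKernel v := by
  simp_rw [one_sub_cos_mul_div_sq]
  rw [integral_const_mul, Measure.integral_comp_mul_right, smul_eq_mul, ← mul_assoc, abs_inv,
    ← sq_abs]
  rcases eq_or_ne x 0 with rfl | hx
  · simp
  · have := abs_pos.2 hx
    field_simp

/-- The first absolute moment in terms of the real part of the characteristic function. -/
lemma integral_abs_mul_integral_absKernel {Ω : Type*} [MeasurableSpace Ω] (μ : Measure Ω)
    [IsProbabilityMeasure μ] {Z : Ω → ℝ} (hZm : Measurable Z) (hZ : Integrable Z μ) :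
    (∫ ω, |Z ω| ∂μ) * ∫ v, absKernel v =
      ∫ u : ℝ, (1 - ∫ ω, Real.cos (u * Z ω) ∂μ) / u ^ 2 := by
  have hnonneg (x u : ℝ) : 0 ≤ (1 - Real.cos (u * x)) / u ^ 2 :=
    div_nonneg (sub_nonneg.2 (Real.cos_le_one _)) (sq_nonneg u)
  have hint : Integrable
      (Function.uncurry fun (ω : Ω) (u : ℝ) => (1 - Real.cos (u * Z ω)) / u ^ 2)
      (μ.prod volume) := by
    rw [integrable_prod_iff]
    · refine ⟨ae_of_all _ fun ω => integrable_one_sub_cos_mul_div_sq (Z ω), ?_⟩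
      simp only [Function.uncurry_apply_pair, Real.norm_of_nonneg (hnonneg _ _),
        integral_one_sub_cos_mul_div_sq]
      exact hZ.abs.mul_const _
    · refine Measurable.aestronglyMeasurable ?_
      unfold Function.uncurry
      fun_prop
  rw [← integral_mul_const]
  simp_rw [← integral_one_sub_cos_mul_div_sq]
  rw [integral_integral_swap hint]
  congr with u
  rw [integral_div, integral_sub (integrable_const _), integral_const]
  · simp
  · exact Integrable.of_bound (by fun_prop) 1 (ae_of_all _ fun ω => Real.abs_cos_le_one _)

lemma integral_abs_gaussianReal_two : ∫ x, |x| ∂gaussianReal 0 2 = 2 / √Real.pi := by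
  rw [integral_gaussianReal_eq_integral_smul two_ne_zero]
  have h (x : ℝ) : gaussianPDFReal 0 2 x • |x| =
      (√(4 * Real.pi))⁻¹ * (|x| ^ (1 : ℝ) * Real.exp (-(1 / 4) * |x| ^ (2 : ℝ))) := by
    rw [gaussianPDFReal_def, Real.rpow_one, Real.rpow_two, sq_abs, smul_eq_mul]
    push_cast
    ring_nf
  simp_rw [h]
  rw [integral_const_mul, integral_comp_abs
    (f := fun x => x ^ (1 : ℝ) * Real.exp (-(1 / 4) * x ^ (2 : ℝ))),
    integral_rpow_mul_exp_neg_mul_rpow two_pos (by norm_num) (by norm_num),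
    Real.sqrt_mul (by norm_num), show (4 : ℝ) = 2 ^ 2 by norm_num, Real.sqrt_sq two_pos.le]
  norm_num [Real.rpow_neg_one]
  field_simp
  norm_num

lemma integral_cos_gaussianReal_two (u : ℝ) :
    ∫ x, Real.cos (u * x) ∂gaussianReal 0 2 = Real.exp (-u ^ 2) := by
  have h := charFun_gaussianReal (μ := 0) (v := 2) u
  rw [charFun_apply_real] at h
  have h2 := congrArg Complex.re h
  rw [← RCLike.re_eq_complex_re, ← integral_re] at h2
  · have e : Complex.exp (u * (0 : ℝ) * Complex.I - ((2 : NNReal) : ℝ) * (u : ℂ) ^ 2 / 2) =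
        (Real.exp (-u ^ 2) : ℝ) := by
      push_cast
      congr 1
      ring
    rw [e] at h2
    simp only [RCLike.re_eq_complex_re, Complex.ofReal_re] at h2
    rw [← h2]
    congr with x
    rw [← Complex.ofReal_mul, Complex.exp_ofReal_mul_I_re]
  · refine Integrable.of_bound (by fun_prop) 1 (ae_of_all _ fun x => ?_)
    rw [← Complex.ofReal_mul, Complex.norm_exp_ofReal_mul_I]

lemma integral_one_sub_exp_neg_sq_div_sq :
    ∫ u : ℝ, (1 - Real.exp (-u ^ 2)) / u ^ 2 = 2 / √Real.pi * ∫ v, absKernel v := by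
  have h := integral_abs_mul_integral_absKernel (gaussianReal 0 2) measurable_id
    ((IsGaussian.memLp_id (gaussianReal 0 2) 1 (by simp)).integrable le_rfl)
  simp only [id, integral_abs_gaussianReal_two, integral_cos_gaussianReal_two] at h
  exact h.symm

lemma two_mul_sq_mul_one_sub_cos_div {c : ℝ} (hc : c ≠ 0) (u : ℝ) :
    2 * c ^ 2 * (1 - Real.cos (u / c)) = u ^ 2 * Real.sinc (u / (2 * c)) ^ 2 := by
  rcases eq_or_ne u 0 with rfl | hu
  · simp
  · rw [Real.sinc_of_ne_zero (by positivity), show u / c = 2 * (u / (2 * c)) by field_simp,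
      Real.cos_two_mul, Real.cos_sq']
    field_simp
    ring

lemma tendsto_integral_one_sub_exp_div_sq :
    Tendsto (fun c : ℝ => ∫ u : ℝ,
      (1 - Real.exp (-(2 * c ^ 2 * (1 - Real.cos (u / c))))) / u ^ 2) atTop
      (nhds (∫ u : ℝ, (1 - Real.exp (-u ^ 2)) / u ^ 2)) := by
  refine tendsto_integral_filter_of_dominated_convergence (fun u => 2 * (1 + u ^ 2)⁻¹) ?_ ?_
    (integrable_inv_one_add_sq.const_mul 2) (ae_of_all _ fun u => ?_)
  · exact Eventually.of_forall fun c => Measurable.aestronglyMeasurable (by fun_prop)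
  · filter_upwards [eventually_gt_atTop 0] with c hc
    refine ae_of_all _ fun u => ?_
    set s := 2 * c ^ 2 * (1 - Real.cos (u / c)) with hs
    have hs0 : 0 ≤ s := mul_nonneg (by positivity) (sub_nonneg.2 (Real.cos_le_one _))
    have hsu : s ≤ u ^ 2 := by
      have h := Real.one_sub_sq_div_two_le_cos (x := u / c)
      calc s ≤ 2 * c ^ 2 * ((u / c) ^ 2 / 2) := by rw [hs]; gcongr; linarith
        _ = u ^ 2 := by field_simp
    have h1 : 0 ≤ 1 - Real.exp (-s) := by simpa using hs0
    have h2 := Real.one_sub_le_exp_neg s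
    have h3 := Real.exp_pos (-s)
    rw [Real.norm_of_nonneg (by positivity), ← div_eq_mul_inv]
    rcases eq_or_ne u 0 with rfl | hu
    · simp
    · rw [div_le_div_iff₀ (by positivity) (by positivity)]
      nlinarith [mul_nonneg h3.le (sq_nonneg u)]
  · have h0 : Tendsto (fun c : ℝ => u / (2 * c)) atTop (nhds 0) :=
      tendsto_const_nhds.div_atTop (tendsto_id.const_mul_atTop two_pos)
    have h1 : Tendsto (fun c : ℝ => u ^ 2 * Real.sinc (u / (2 * c)) ^ 2) atTop (nhds (u ^ 2)) := by
      simpa using (((Real.continuous_sinc.tendsto 0).comp h0).pow 2).const_mul (u ^ 2)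
    have h2 : Tendsto (fun c : ℝ => 2 * c ^ 2 * (1 - Real.cos (u / c))) atTop (nhds (u ^ 2)) := by
      refine h1.congr' ?_
      filter_upwards [eventually_ne_atTop 0] with c hc
      exact (two_mul_sq_mul_one_sub_cos_div hc u).symm
    exact (((Real.continuous_exp.tendsto _).comp h2.neg).const_sub 1).div_const _

lemma integrable_mul_poissonMeasure {r : NNReal} {f : ℕ → ℝ}
    (hf : Integrable (fun k => f (k + 1)) (poissonMeasure r)) :
    Integrable (fun k : ℕ => (k : ℝ) * f k) (poissonMeasure r) := by
  rw [integrable_poissonMeasure_iff] at hf ⊢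
  rw [← summable_nat_add_iff 1]
  refine (hf.mul_left (r : ℝ)).congr fun n => ?_
  rw [norm_mul, Real.norm_natCast, Nat.factorial_succ]
  push_cast
  field_simp
  ring

/-- The Stein–Chen identity for the Poisson distribution. -/
lemma integral_mul_poissonMeasure {r : NNReal} {f : ℕ → ℝ}
    (hf : Integrable (fun k => f (k + 1)) (poissonMeasure r)) :
    ∫ k : ℕ, (k : ℝ) * f k ∂poissonMeasure r = r * ∫ k, f (k + 1) ∂poissonMeasure r := by
  have hs := (hasSum_integral_poissonMeasure (integrable_mul_poissonMeasure hf)).summable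
  rw [integral_poissonMeasure, integral_poissonMeasure, hs.tsum_eq_zero_add, ← tsum_mul_left]
  simp only [CharP.cast_eq_zero, zero_mul, smul_zero, zero_add]
  congr with n
  rw [Nat.factorial_succ, smul_eq_mul, smul_eq_mul]
  push_cast
  field_simp
  ring

lemma memLp_two_natCast_poissonMeasure (r : NNReal) :
    MemLp (fun k : ℕ => (k : ℝ)) 2 (poissonMeasure r) := by
  rw [memLp_two_iff_integrable_sq .of_discrete]
  have h1 : Integrable (fun k : ℕ => (k : ℝ)) (poissonMeasure r) := by
    simpa using integrable_mul_poissonMeasure (r := r) (f := fun _ => 1) (integrable_const 1)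
  have h2 := integrable_mul_poissonMeasure (r := r) (f := fun k => (k : ℝ))
    (by simpa using h1.add (integrable_const 1))
  simpa [sq] using h2

lemma integrable_natCast_poissonMeasure (r : NNReal) :
    Integrable (fun k : ℕ => (k : ℝ)) (poissonMeasure r) :=
  (memLp_two_natCast_poissonMeasure r).integrable one_le_two

lemma integral_natCast_poissonMeasure (r : NNReal) :
    ∫ k : ℕ, (k : ℝ) ∂poissonMeasure r = r := by
  simpa using integral_mul_poissonMeasure (r := r) (f := fun _ => 1) (integrable_const 1)

lemma integral_natCast_sq_poissonMeasure (r : NNReal) :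
    ∫ k : ℕ, (k : ℝ) ^ 2 ∂poissonMeasure r = r ^ 2 + r := by
  have h1 := integrable_natCast_poissonMeasure r
  have h2 := integral_mul_poissonMeasure (r := r) (f := fun k => (k : ℝ))
    (by simpa using h1.add (integrable_const 1))
  simp only [Nat.cast_add, Nat.cast_one] at h2
  rw [integral_add h1 (integrable_const 1), integral_natCast_poissonMeasure] at h2
  simp only [sq, h2, integral_const, probReal_univ, smul_eq_mul, mul_one]
  ring

/-- The joint law of two independent Poisson variables with the same mean. -/
noncomputable abbrev poissonPair (r : NNReal) : Measure (ℕ × ℕ) :=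
  (poissonMeasure r).prod (poissonMeasure r)

lemma memLp_two_fst_poissonPair (r : NNReal) :
    MemLp (fun z : ℕ × ℕ => (z.1 : ℝ)) 2 (poissonPair r) :=
  (memLp_two_natCast_poissonMeasure r).comp_fst _

lemma memLp_two_snd_poissonPair (r : NNReal) :
    MemLp (fun z : ℕ × ℕ => (z.2 : ℝ)) 2 (poissonPair r) :=
  (memLp_two_natCast_poissonMeasure r).comp_snd _

lemma memLp_two_sub_poissonPair (r : NNReal) :
    MemLp (fun z : ℕ × ℕ => (z.1 - z.2 : ℝ)) 2 (poissonPair r) :=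
  (memLp_two_fst_poissonPair r).sub (memLp_two_snd_poissonPair r)

lemma integral_fst_poissonPair (r : NNReal) (f : ℕ → ℝ) :
    ∫ z, f z.1 ∂poissonPair r = ∫ k, f k ∂poissonMeasure r := by
  simpa using integral_fun_fst (μ := poissonMeasure r) (ν := poissonMeasure r) f

lemma integral_snd_poissonPair (r : NNReal) (f : ℕ → ℝ) :
    ∫ z, f z.2 ∂poissonPair r = ∫ k, f k ∂poissonMeasure r := by
  simpa using integral_fun_snd (μ := poissonMeasure r) (ν := poissonMeasure r) f

lemma integral_fst_mul_abs_sub_poissonPair (r : NNReal) :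
    ∫ z, (z.1 * |(z.1 - z.2 : ℝ)|) ∂poissonPair r =
      r * ∫ z, |(z.1 - z.2 + 1 : ℝ)| ∂poissonPair r := by
  have hint : Integrable (fun z : ℕ × ℕ => (z.1 * |(z.1 - z.2 : ℝ)|)) (poissonPair r) :=
    (memLp_two_fst_poissonPair r).integrable_mul (memLp_two_sub_poissonPair r).abs
  have hint' : Integrable (fun z : ℕ × ℕ => |(z.1 - z.2 + 1 : ℝ)|) (poissonPair r) :=
    (((memLp_two_sub_poissonPair r).integrable one_le_two).add (integrable_const 1)).abs
  rw [integral_prod_symm _ hint, integral_prod_symm _ hint', ← integral_const_mul]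
  congr with y
  have h := integral_mul_poissonMeasure (r := r) (f := fun k => |(k - y : ℝ)|)
    ((((integrable_natCast_poissonMeasure r).add (integrable_const 1)).sub
      (integrable_const (y : ℝ))).abs.congr (ae_of_all _ fun k => by simp))
  rw [h]
  congr with k
  push_cast
  ring_nf

lemma integral_snd_mul_abs_sub_poissonPair (r : NNReal) :
    ∫ z, (z.2 * |(z.1 - z.2 : ℝ)|) ∂poissonPair r =
      r * ∫ z, |(z.1 - z.2 - 1 : ℝ)| ∂poissonPair r := by
  rw [← integral_prod_swap, ← integral_prod_swap (fun z : ℕ × ℕ => |(z.1 - z.2 - 1 : ℝ)|)]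
  convert integral_fst_mul_abs_sub_poissonPair r using 3 with z
  · simp [abs_sub_comm]
  · congr with z
    rw [← abs_neg]
    simp only [Prod.fst_swap, Prod.snd_swap]
    ring_nf

lemma abs_add_one_add_abs_sub_one (m n : ℕ) :
    |(m - n + 1 : ℝ)| + |(m - n - 1 : ℝ)| = 2 * |(m - n : ℝ)| + 2 * if m = n then 1 else 0 := by
  rcases lt_trichotomy m n with h | rfl | h
  · have : (m + 1 : ℝ) ≤ n := mod_cast h
    rw [abs_of_nonpos (by linarith), abs_of_nonpos (by linarith), abs_of_nonpos (by linarith),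
      if_neg h.ne]
    ring
  · norm_num
  · have : (n + 1 : ℝ) ≤ m := mod_cast h
    rw [abs_of_nonneg (by linarith), abs_of_nonneg (by linarith), abs_of_nonneg (by linarith),
      if_neg h.ne']
    ring

lemma integral_add_mul_abs_sub_poissonPair (r : NNReal) :
    ∫ z, ((z.1 + z.2) * |(z.1 - z.2 : ℝ)|) ∂poissonPair r =
      2 * r * (∫ z, |(z.1 - z.2 : ℝ)| ∂poissonPair r) +
        2 * r * ∫ z, (if z.1 = z.2 then 1 else 0 : ℝ) ∂poissonPair r := by
  have hD := (memLp_two_sub_poissonPair r).integrable one_le_two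
  have hI : Integrable (fun z : ℕ × ℕ => (if z.1 = z.2 then 1 else 0 : ℝ)) (poissonPair r) :=
    Integrable.of_bound .of_discrete 1 (ae_of_all _ fun z => by split_ifs <;> simp)
  have hXD : Integrable (fun z : ℕ × ℕ => (z.1 * |(z.1 - z.2 : ℝ)|)) (poissonPair r) :=
    (memLp_two_fst_poissonPair r).integrable_mul (memLp_two_sub_poissonPair r).abs
  have hYD : Integrable (fun z : ℕ × ℕ => (z.2 * |(z.1 - z.2 : ℝ)|)) (poissonPair r) :=
    (memLp_two_snd_poissonPair r).integrable_mul (memLp_two_sub_poissonPair r).abs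
  have hA : Integrable (fun z : ℕ × ℕ => |(z.1 - z.2 + 1 : ℝ)|) (poissonPair r) :=
    (hD.add (integrable_const 1)).abs
  have hB : Integrable (fun z : ℕ × ℕ => |(z.1 - z.2 - 1 : ℝ)|) (poissonPair r) :=
    (hD.sub (integrable_const 1)).abs
  simp_rw [add_mul]
  rw [integral_add hXD hYD,
    integral_fst_mul_abs_sub_poissonPair, integral_snd_mul_abs_sub_poissonPair, ← mul_add,
    ← integral_add hA hB]
  simp_rw [abs_add_one_add_abs_sub_one]
  rw [integral_add (hD.abs.const_mul 2) (hI.const_mul 2), integral_const_mul, integral_const_mul]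
  ring

lemma min_eq_half_add_sub_abs_sub (x y : ℝ) : min x y = (x + y - |x - y|) / 2 := by
  rcases le_total x y with h | h
  · rw [min_eq_left h, abs_of_nonpos (by linarith)]; ring
  · rw [min_eq_right h, abs_of_nonneg (by linarith)]; ring

lemma variance_min_poissonPair (r : NNReal) :
    variance (fun z : ℕ × ℕ => min (z.1 : ℝ) z.2) (poissonPair r) =
      r - r * (∫ z, (if z.1 = z.2 then 1 else 0 : ℝ) ∂poissonPair r) -
        (∫ z, |(z.1 - z.2 : ℝ)| ∂poissonPair r) ^ 2 / 4 := by
  have hX := memLp_two_fst_poissonPair r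
  have hY := memLp_two_snd_poissonPair r
  have hS : MemLp (fun z : ℕ × ℕ => (z.1 + z.2 : ℝ)) 2 (poissonPair r) := hX.add hY
  have hD : MemLp (fun z : ℕ × ℕ => |(z.1 - z.2 : ℝ)|) 2 (poissonPair r) :=
    (memLp_two_sub_poissonPair r).abs
  simp_rw [min_eq_half_add_sub_abs_sub]
  have hM : MemLp (fun z : ℕ × ℕ => (z.1 + z.2 - |(z.1 - z.2 : ℝ)|) / 2) 2 (poissonPair r) := by
    simpa only [div_eq_inv_mul, Pi.sub_apply] using (hS.sub hD).const_mul (2 : ℝ)⁻¹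
  have hSD : Integrable (fun z : ℕ × ℕ => ((z.1 + z.2) * |(z.1 - z.2 : ℝ)|)) (poissonPair r) :=
    hS.integrable_mul hD
  have hmean : ∫ z, ((z.1 + z.2 - |(z.1 - z.2 : ℝ)|) / 2) ∂poissonPair r =
      r - (∫ z, |(z.1 - z.2 : ℝ)| ∂poissonPair r) / 2 := by
    rw [integral_div, integral_sub (hS.integrable one_le_two) (hD.integrable one_le_two),
      integral_add (hX.integrable one_le_two) (hY.integrable one_le_two),
      integral_fst_poissonPair r (fun k => (k : ℝ)),
      integral_snd_poissonPair r (fun k => (k : ℝ)), integral_natCast_poissonMeasure]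
    ring
  have hsq (z : ℕ × ℕ) : ((z.1 + z.2 - |(z.1 - z.2 : ℝ)|) / 2) ^ 2 =
      ((z.1 : ℝ) ^ 2 + (z.2 : ℝ) ^ 2 - (z.1 + z.2) * |(z.1 - z.2 : ℝ)|) / 2 := by
    have := sq_abs (z.1 - z.2 : ℝ)
    linear_combination this / 4
  have hsum : Integrable (fun z : ℕ × ℕ => ((z.1 : ℝ) ^ 2 + (z.2 : ℝ) ^ 2)) (poissonPair r) :=
    hX.integrable_sq.add hY.integrable_sq
  rw [variance_eq_sub hM, hmean]
  simp only [Pi.pow_apply, hsq]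
  rw [integral_div, integral_sub hsum hSD,
    integral_add hX.integrable_sq hY.integrable_sq,
    integral_fst_poissonPair r (fun k => (k : ℝ) ^ 2),
    integral_snd_poissonPair r (fun k => (k : ℝ) ^ 2), integral_natCast_sq_poissonMeasure,
    integral_add_mul_abs_sub_poissonPair]
  ring

lemma integral_cos_sub_poissonPair (r : NNReal) (u : ℝ) :
    ∫ z, Real.cos (u * (z.1 - z.2)) ∂poissonPair r =
      Real.exp (-(2 * r * (1 - Real.cos u))) := by
  have hchar (v : ℝ) : ∫ k : ℕ, Complex.exp (v * k * Complex.I) ∂poissonMeasure r =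
      Complex.exp (r * (Complex.exp (v * Complex.I) - 1)) := by
    rw [← charFun_map_cast_poissonMeasure, charFun_apply_real,
      integral_map .of_discrete (by fun_prop)]
    simp
  have h : ∫ z, Complex.exp (u * (z.1 - z.2) * Complex.I) ∂poissonPair r =
      (Real.exp (-(2 * r * (1 - Real.cos u))) : ℝ) := by
    have hmul (z : ℕ × ℕ) : Complex.exp (u * (z.1 - z.2) * Complex.I) =
        Complex.exp (u * z.1 * Complex.I) * Complex.exp ((-u : ℝ) * z.2 * Complex.I) := by
      rw [← Complex.exp_add]
      push_cast
      ring_nf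
    simp_rw [hmul]
    rw [integral_prod_mul (fun k : ℕ => Complex.exp (u * k * Complex.I))
      (fun k : ℕ => Complex.exp ((-u : ℝ) * k * Complex.I)), hchar, hchar, ← Complex.exp_add]
    push_cast
    rw [Complex.cos]
    ring_nf
  have h2 := congrArg Complex.re h
  rw [← RCLike.re_eq_complex_re, ← integral_re] at h2
  · simp only [RCLike.re_eq_complex_re, Complex.ofReal_re] at h2
    rw [← h2]
    congr with z
    rw [← Complex.exp_ofReal_mul_I_re]
    push_cast
    rfl
  · refine Integrable.of_bound .of_discrete 1 (ae_of_all _ fun z => ?_)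
    rw [show (u * (z.1 - z.2) * Complex.I : ℂ) = ((u * (z.1 - z.2) : ℝ) : ℂ) * Complex.I by
      push_cast; rfl, Complex.norm_exp_ofReal_mul_I]

lemma integral_cos_mul_natCast_sub (m n : ℕ) :
    ∫ u in (0 : ℝ)..2 * Real.pi, Real.cos (u * (m - n)) =
      2 * Real.pi * if m = n then 1 else 0 := by
  rcases eq_or_ne m n with rfl | h
  · simp
  · have hne : (m - n : ℝ) ≠ 0 := sub_ne_zero.2 (mod_cast h)
    have hsin : Real.sin (2 * Real.pi * (m - n)) = 0 := by
      have := Real.sin_int_mul_pi (2 * (m - n))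
      push_cast at this
      rw [← this]
      ring_nf
    rw [intervalIntegral.integral_comp_mul_right _ hne, integral_cos, hsin, if_neg h]
    simp

lemma two_pi_mul_integral_eq_poissonPair (r : NNReal) :
    2 * Real.pi * ∫ z, (if z.1 = z.2 then 1 else 0 : ℝ) ∂poissonPair r =
      ∫ u in (0 : ℝ)..2 * Real.pi, Real.exp (-(2 * r * (1 - Real.cos u))) := by
  simp_rw [← integral_cos_sub_poissonPair]
  rw [intervalIntegral_integral_swap, ← integral_const_mul]
  · simp_rw [integral_cos_mul_natCast_sub]
  · rw [Set.uIoc_of_le (by positivity)]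
    refine Integrable.of_bound ?_ 1 (ae_of_all _ fun z => Real.abs_cos_le_one _)
    refine Measurable.aestronglyMeasurable ?_
    unfold Function.uncurry
    fun_prop

lemma tendsto_integral_eq_poissonPair :
    Tendsto (fun r : NNReal => ∫ z, (if z.1 = z.2 then 1 else 0 : ℝ) ∂poissonPair r) atTop
      (nhds 0) := by
  have h : Tendsto (fun r : NNReal => ∫ u in (0 : ℝ)..2 * Real.pi,
      Real.exp (-(2 * r * (1 - Real.cos u)))) atTop
      (nhds (∫ _ in (0 : ℝ)..2 * Real.pi, (0 : ℝ))) := by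
    refine intervalIntegral.tendsto_integral_filter_of_dominated_convergence (fun _ => 1)
      (Eventually.of_forall fun r => by fun_prop) (Eventually.of_forall fun r => ?_)
      intervalIntegrable_const ?_
    · refine ae_of_all _ fun u _ => ?_
      rw [Real.norm_of_nonneg (Real.exp_nonneg _), Real.exp_le_one_iff, neg_nonpos]
      exact mul_nonneg (by positivity) (sub_nonneg.2 (Real.cos_le_one u))
    · filter_upwards [Measure.ae_ne volume (2 * Real.pi)] with u hu hmem
      rw [Set.uIoc_of_le (by positivity)] at hmem
      have hcos : Real.cos u < 1 := by
        refine lt_of_le_of_ne (Real.cos_le_one u) ?_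
        rw [Ne, Real.cos_eq_one_iff_of_lt_of_lt (by linarith [hmem.1, Real.pi_pos])
          (lt_of_le_of_ne hmem.2 hu)]
        exact hmem.1.ne'
      exact Real.tendsto_exp_neg_atTop_nhds_zero.comp
        (((NNReal.tendsto_coe_atTop.2 tendsto_id).const_mul_atTop two_pos).atTop_mul_const
          (sub_pos.2 hcos))
  simp_rw [← two_pi_mul_integral_eq_poissonPair] at h
  have h2 := h.const_mul (2 * Real.pi)⁻¹
  simp only [intervalIntegral.integral_zero, mul_zero] at h2
  refine h2.congr fun r => ?_
  rw [inv_mul_cancel_left₀ (by positivity)]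

lemma integral_abs_sub_poissonPair_div_sqrt (r : NNReal) :
    (∫ z, |(z.1 - z.2 : ℝ)| ∂poissonPair r) / √r * ∫ v, absKernel v =
      ∫ u : ℝ, (1 - Real.exp (-(2 * √r ^ 2 * (1 - Real.cos (u / √r))))) / u ^ 2 := by
  have h := integral_abs_mul_integral_absKernel (poissonPair r)
    (Z := fun z : ℕ × ℕ => (z.1 - z.2 : ℝ) / √r) .of_discrete
    (((memLp_two_sub_poissonPair r).integrable one_le_two).div_const _)
  simp_rw [abs_div, abs_of_nonneg (Real.sqrt_nonneg (r : ℝ))] at h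
  rw [integral_div] at h
  rw [h]
  congr with u
  rw [Real.sq_sqrt r.coe_nonneg, ← integral_cos_sub_poissonPair]
  simp_rw [mul_div_left_comm u, mul_comm (u / _)]

lemma tendsto_integral_abs_sub_poissonPair_div_sqrt :
    Tendsto (fun r : NNReal => (∫ z, |(z.1 - z.2 : ℝ)| ∂poissonPair r) / √r) atTop
      (nhds (2 / √Real.pi)) := by
  have hK := integral_absKernel_pos.ne'
  have hsqrt : Tendsto (fun r : NNReal => √(r : ℝ)) atTop atTop :=
    Real.tendsto_sqrt_atTop.comp (NNReal.tendsto_coe_atTop.2 tendsto_id)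
  have h := (tendsto_integral_one_sub_exp_div_sq.comp hsqrt).div_const (∫ v, absKernel v)
  rw [integral_one_sub_exp_neg_sq_div_sq, mul_div_cancel_right₀ _ hK] at h
  refine h.congr fun r => ?_
  rw [Function.comp_apply, ← integral_abs_sub_poissonPair_div_sqrt, mul_div_cancel_right₀ _ hK]

lemma tendsto_variance_min_poissonPair_div :
    Tendsto (fun r : NNReal =>
      variance (fun z : ℕ × ℕ => min (z.1 : ℝ) z.2) (poissonPair r) / r) atTop
      (nhds (1 - 1 / Real.pi)) := by
  have h := (tendsto_integral_eq_poissonPair.const_sub 1).sub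
    ((tendsto_integral_abs_sub_poissonPair_div_sqrt.pow 2).div_const 4)
  have hlim : (1 - 0 - (2 / √Real.pi) ^ 2 / 4 : ℝ) = 1 - 1 / Real.pi := by
    rw [div_pow, Real.sq_sqrt Real.pi_pos.le]
    ring
  rw [hlim] at h
  refine h.congr' ?_
  filter_upwards [eventually_gt_atTop 0] with r hr
  have hr' : (r : ℝ) ≠ 0 := by positivity
  rw [variance_min_poissonPair, div_pow, Real.sq_sqrt r.coe_nonneg]
  field_simp

/-- If for each `t > 0`, `X t` and `Y t` are independent Poisson random
variables, both with mean `λ·t` (`λ > 0`), then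
`Var[min(X_t, Y_t)] / t → λ·(1 − 1/π)` as `t → ∞`. -/
theorem synchronized_flow_variance_rate_equal
    {Ω : Type*} [MeasurableSpace Ω] (μ : Measure Ω) [IsProbabilityMeasure μ]
    (lam : ℝ) (hlam : 0 < lam)
    (X Y : ℝ → Ω → ℕ)
    (hXm : ∀ t, 0 < t → Measurable (X t)) (hYm : ∀ t, 0 < t → Measurable (Y t))
    (hindep : ∀ t, 0 < t → IndepFun (X t) (Y t) μ)
    (hX : ∀ t, 0 < t → μ.map (X t) = poissonMeasure (lam * t).toNNReal)
    (hY : ∀ t, 0 < t → μ.map (Y t) = poissonMeasure (lam * t).toNNReal) :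
    Tendsto (fun t => variance (fun ω => (min (X t ω) (Y t ω) : ℝ)) μ / t) atTop
      (nhds (lam * (1 - 1 / Real.pi))) := by
  have hr : Tendsto (fun t : ℝ => (lam * t).toNNReal) atTop atTop :=
    tendsto_real_toNNReal_atTop.comp (tendsto_id.const_mul_atTop hlam)
  refine ((tendsto_variance_min_poissonPair_div.comp hr).const_mul lam).congr' ?_
  filter_upwards [eventually_gt_atTop 0] with t ht
  have hlaw : μ.map (fun ω => (X t ω, Y t ω)) = poissonPair (lam * t).toNNReal := by
    rw [(indepFun_iff_map_prod_eq_prod_map_map (hXm t ht).aemeasurable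
      (hYm t ht).aemeasurable).1 (hindep t ht), hX t ht, hY t ht]
  rw [Function.comp_apply, ← hlaw,
    variance_map .of_discrete ((hXm t ht).prodMk (hYm t ht)).aemeasurable,
    Real.coe_toNNReal _ (mul_pos hlam ht).le]
  simp only [Function.comp_def]
  field_simp
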